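/- Let m > 0, Q₀ > 1, q∞ ∈ (Q₀^{−1}, Q₀), ϑ₀ ∈ (0, π/2), and let ξ* = (p*, q*) be the explicit point-vortex trajectory. Let C₀ > 0 and let g : (0,∞) → ℝ be a C² function satisfying |g(r)| + |g'(r)| + |g''(r)| ≤ C₀ε² for all r > 0. Then for all sufficiently small ε > 0 there is a unique pair ξ̄ = (p̄, q̄) : [0,∞) → ℝ² with p̄(0) = 0 and lim_{t→∞} q̄(t) = 0, lying in the ball {‖(t+1)^{−1}p̄‖_{L∞[0,∞)} + ‖(t+1)²q̄‖_{L∞[0,∞)} ≤ ε²|log ε|}, such that ξ₀ = ξ* + ξ̄ = (p₀, q₀) solves the modified point-vortex system ṗ₀ = F(q₀, p₀) + g(q₀/ε), q̇₀ = −F(p₀, q₀) on [0,∞). Moreover this solution satisfies, for an absolute constant C > 0: ‖(t+1)^{−1}p̄‖_{L∞[0,∞)} + ‖ṗ̄‖_{L∞[0,∞)} ≤ Cε² and ‖(t+1)²q̄‖_{L∞[0,∞)} + ‖(t+1)³q̇̄‖_{L∞[0,∞)} ≤ Cε². -/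

import Mathlib

open MeasureTheory Metric Real Filter Topology Set

noncomputable section

/-- `arccot`, with values in `(0, π)`. -/
def arccotR (x : ℝ) : ℝ := π / 2 - Real.arctan x

/-- The explicit angle `ϑ(t) = (1/2)·arccot(cot(2ϑ₀) + m t/(4q∞²))`. -/
def thetaF (m qinf ϑ₀ t : ℝ) : ℝ :=
  (1 / 2) * arccotR (Real.cot (2 * ϑ₀) + m * t / (4 * qinf ^ 2))

/-- `p*(t) = q∞ / sin ϑ(t)`. -/
def pstarF (m qinf ϑ₀ t : ℝ) : ℝ := qinf / Real.sin (thetaF m qinf ϑ₀ t)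

/-- `q*(t) = q∞ / cos ϑ(t)`. -/
def qstarF (m qinf ϑ₀ t : ℝ) : ℝ := qinf / Real.cos (thetaF m qinf ϑ₀ t)

/-- `r(t) = 2q∞ / sin(2ϑ(t))`, so that `p* + i q* = r e^{iϑ}`. -/
def rstarF (m qinf ϑ₀ t : ℝ) : ℝ := 2 * qinf / Real.sin (2 * thetaF m qinf ϑ₀ t)

/-- The point-vortex nonlinearity `F(x,y) = (m/2)(1/x − x/(x²+y²))`. -/
def Fpv (m x y : ℝ) : ℝ := (m / 2) * (1 / x - x / (x ^ 2 + y ^ 2))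


theorem eq_of_hasDerivAt_zero_of_nonneg {f : ℝ → ℝ} (hf : ∀ t, 0 ≤ t → HasDerivAt f 0 t)
    {t : ℝ} (ht : 0 ≤ t) : f t = f 0 := by
  have h := (convex_Ici (0 : ℝ)).norm_image_sub_le_of_norm_hasDerivWithin_le (f := f)
    (f' := fun _ => 0) (C := 0) (fun x hx => (hf x hx).hasDerivWithinAt) (fun x _ => by simp)
    (mem_Ici.2 le_rfl) (mem_Ici.2 ht)
  have h2 : ‖f t - f 0‖ ≤ 0 := by simpa using h
  exact sub_eq_zero.1 (norm_le_zero_iff.1 h2)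

theorem abs_sub_le_of_hasDerivAt_nonneg {f f' : ℝ → ℝ} {C : ℝ}
    (hf : ∀ t, 0 ≤ t → HasDerivAt f (f' t) t) (hC : ∀ t, 0 ≤ t → |f' t| ≤ C)
    {t : ℝ} (ht : 0 ≤ t) : |f t - f 0| ≤ C * t := by
  have h := (convex_Ici (0 : ℝ)).norm_image_sub_le_of_norm_hasDerivWithin_le (f := f)
    (f' := f') (C := C) (fun x hx => (hf x hx).hasDerivWithinAt) (fun x hx => hC x hx)
    (mem_Ici.2 le_rfl) (mem_Ici.2 ht)
  simpa [abs_of_nonneg ht] using h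

theorem abs_sub_le_of_hasDerivAt {f f' : ℝ → ℝ} {C : ℝ}
    (hf : ∀ t, HasDerivAt f (f' t) t) (hC : ∀ t, |f' t| ≤ C) (x y : ℝ) :
    |f y - f x| ≤ C * |y - x| := by
  simpa using (convex_univ (𝕜 := ℝ) (E := ℝ)).norm_image_sub_le_of_norm_hasDerivWithin_le (f := f)
    (f' := f') (C := C) (fun x _ => (hf x).hasDerivWithinAt) (fun x _ => hC x)
    (mem_univ x) (mem_univ y)

theorem mul_sub_le_of_le_hasDerivAt {f f' : ℝ → ℝ} {c : ℝ}
    (hf : ∀ t, HasDerivAt f (f' t) t) (hc : ∀ t, c ≤ f' t) {x y : ℝ} (hxy : x ≤ y) :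
    c * (y - x) ≤ f y - f x := by
  refine mul_sub_le_image_sub_of_le_deriv (fun t => (hf t).differentiableAt) ?_ hxy
  intro t
  rw [(hf t).deriv]
  exact hc t

/-- A function on the line whose derivative is bounded below by a positive constant has a
differentiable global inverse. -/
theorem exists_inverse_of_le_hasDerivAt {f f' : ℝ → ℝ} {c : ℝ} (hc : 0 < c)
    (hf : ∀ x, HasDerivAt f (f' x) x) (hf' : ∀ x, c ≤ f' x) :
    ∃ h : ℝ → ℝ, (∀ y, f (h y) = y) ∧ (∀ x, h (f x) = x) ∧
      ∀ y, HasDerivAt h (f' (h y))⁻¹ y := by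
  have hcont : Continuous f := continuous_iff_continuousAt.2 fun x => (hf x).continuousAt
  have hmono : StrictMono f := by
    refine strictMono_of_deriv_pos fun x => ?_
    rw [(hf x).deriv]
    exact hc.trans_le (hf' x)
  have htop : Tendsto f atTop atTop := by
    have h1 : Tendsto (fun x : ℝ => f 0 + c * x) atTop atTop :=
      tendsto_atTop_add_const_left _ _ (tendsto_id.const_mul_atTop hc)
    refine tendsto_atTop_mono' _ ?_ h1
    filter_upwards [eventually_ge_atTop (0 : ℝ)] with x hx
    have := mul_sub_le_of_le_hasDerivAt hf hf' hx
    linarith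
  have hbot : Tendsto f atBot atBot := by
    have h1 : Tendsto (fun x : ℝ => f 0 + c * x) atBot atBot :=
      tendsto_atBot_add_const_left _ _ (tendsto_id.const_mul_atBot hc)
    refine tendsto_atBot_mono' _ ?_ h1
    filter_upwards [eventually_le_atBot (0 : ℝ)] with x hx
    have := mul_sub_le_of_le_hasDerivAt hf hf' hx
    linarith
  let φ := (hmono.orderIsoOfSurjective f (hcont.surjective htop hbot)).toHomeomorph
  have hφ : ∀ x, φ x = f x := fun x => rfl
  have hr : ∀ y, f (φ.symm y) = y := fun y => by rw [← hφ]; exact φ.apply_symm_apply y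
  refine ⟨φ.symm, hr, fun x => by rw [← hφ]; exact φ.symm_apply_apply x, fun y => ?_⟩
  exact HasDerivAt.of_local_left_inverse φ.symm.continuous.continuousAt (hf _)
    (hc.trans_le (hf' _)).ne' (Eventually.of_forall hr)

/-- Scalar autonomous equation with bounded positive speed: the time function `T` and the
trajectory `P` through `p₀`, inverse to each other. -/
theorem exists_flow_of_pos_speed {H : ℝ → ℝ} {h₀ h₁ : ℝ} (hh₀ : 0 < h₀) (hH : Continuous H)
    (hlo : ∀ x, h₀ ≤ H x) (hhi : ∀ x, H x ≤ h₁) (p₀ : ℝ) :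
    ∃ T P : ℝ → ℝ, (∀ x, HasDerivAt T (H x)⁻¹ x) ∧ (∀ t, HasDerivAt P (H (P t)) t) ∧
      (∀ x, P (T x) = x) ∧ (∀ t, T (P t) = t) ∧ P 0 = p₀ := by
  have hpos : ∀ x, 0 < H x := fun x => hh₀.trans_le (hlo x)
  have hcont : Continuous fun x => (H x)⁻¹ := hH.inv₀ fun x => (hpos x).ne'
  have hT : ∀ x, HasDerivAt (fun x => ∫ y in p₀..x, (H y)⁻¹) (H x)⁻¹ x := fun x =>
    hcont.integral_hasStrictDerivAt p₀ x |>.hasDerivAt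
  obtain ⟨P, hP1, hP2, hP3⟩ := exists_inverse_of_le_hasDerivAt (c := h₁⁻¹)
    (inv_pos.2 ((hpos 0).trans_le (hhi 0))) hT (fun x => by
      have := hhi x
      have := hpos x
      gcongr)
  refine ⟨_, P, hT, fun t => by simpa using hP3 t, hP2, hP1, ?_⟩
  have := hP2 p₀
  simpa using this

/-- The solution of `E' = b E`, `E a = a` on `[u₀, 2a]`, extended to the line with a small
derivative. -/
theorem exists_extended_exponential {a u₀ β : ℝ} (ha : 0 < a) (hu₀ : 0 < u₀) (hu₀a : u₀ ≤ a)
    {b : ℝ → ℝ} (hb : Continuous b) (hbβ : ∀ u, |b u| ≤ β) (hβ : β * a ≤ 1 / 2) :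
    ∃ E e : ℝ → ℝ, (∀ u, HasDerivAt E (e u) u) ∧ Continuous e ∧ (∀ u, |e u| ≤ 2 * a * β) ∧
      E a = a ∧ ∀ u ∈ Icc u₀ (2 * a), e u = E u * b u := by
  have hβ0 : 0 ≤ β := (abs_nonneg _).trans (hbβ 0)
  set φ : ℝ → ℝ := fun u => ∫ w in a..u, b w with hφdef
  have hφ : ∀ u, HasDerivAt φ (b u) u := fun u => (hb.integral_hasStrictDerivAt a u).hasDerivAt
  have hφc : Continuous φ := continuous_iff_continuousAt.2 fun x => (hφ x).continuousAt
  have hφa : φ a = 0 := by simp [hφdef]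
  set κ : ℝ → ℝ := fun u => max u₀ (min u (2 * a)) with hκ
  have hκc : Continuous κ := by fun_prop
  set e : ℝ → ℝ := fun u => a * Real.exp (φ (κ u)) * b u with he
  have hec : Continuous e := by fun_prop
  set E : ℝ → ℝ := fun u => a + ∫ w in a..u, e w with hE
  have hEd : ∀ u, HasDerivAt E (e u) u := fun u =>
    (hec.integral_hasStrictDerivAt a u).hasDerivAt.const_add a
  have hEa : E a = a := by simp [hE]
  refine ⟨E, e, hEd, hec, fun u => ?_, hEa, fun u hu => ?_⟩
  · have h1 : |φ (κ u)| ≤ 1 / 2 := by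
      have h2 := abs_sub_le_of_hasDerivAt hφ hbβ a (κ u)
      rw [hφa, sub_zero] at h2
      have h3 : |κ u - a| ≤ a := by
        rw [abs_le]
        constructor
        · have : u₀ ≤ κ u := le_max_left _ _
          linarith
        · have : κ u ≤ 2 * a := max_le (by linarith) (min_le_right _ _)
          linarith
      exact h2.trans ((mul_le_mul_of_nonneg_left h3 hβ0).trans hβ)
    have h2 : Real.exp (φ (κ u)) ≤ 2 := by
      have h3 := Real.exp_le_exp.2 (abs_le.1 h1).2
      have h4 : Real.exp (1 / 2) ≤ 2 := by
        have h5 : Real.exp (1 / 2) ^ 2 = Real.exp 1 := by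
          rw [← Real.exp_nat_mul]; norm_num
        have := Real.exp_one_lt_d9
        nlinarith [Real.exp_pos (1 / 2)]
      linarith
    rw [he]
    simp only [abs_mul, abs_of_pos ha, abs_of_pos (Real.exp_pos _)]
    have := hbβ u
    have := Real.exp_pos (φ (κ u))
    calc a * Real.exp (φ (κ u)) * |b u| ≤ a * 2 * β := by gcongr
      _ = 2 * a * β := by ring
  · have hκu : ∀ x ∈ Icc u₀ (2 * a), κ x = x := fun x hx => by
      simp [hκ, min_eq_left hx.2, max_eq_right hx.1]
    have h1 : ∀ x ∈ Icc u₀ (2 * a),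
        HasDerivWithinAt (fun x => E x - a * Real.exp (φ x)) ((fun _ => 0) x)
          (Icc u₀ (2 * a)) x := fun x hx => by
      have h2 := ((hEd x).sub (((hφ x).exp).const_mul a)).hasDerivWithinAt (s := Icc u₀ (2 * a))
      refine h2.congr_deriv ?_
      simp only [he, hκu x hx]
      ring
    have h2 := (convex_Icc u₀ (2 * a)).norm_image_sub_le_of_norm_hasDerivWithin_le (C := 0) h1
      (fun x _ => by simp) (show a ∈ Icc u₀ (2 * a) from ⟨hu₀a, by linarith⟩) hu
    simp only [hEa, hφa, Real.exp_zero, mul_one, sub_self, sub_zero, zero_mul] at h2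
    have h3 : E u = a * Real.exp (φ u) := sub_eq_zero.1 (norm_le_zero_iff.1 h2)
    rw [h3, he]
    simp only [hκu u hu]

theorem Fpv_eq_left (m : ℝ) {p q : ℝ} (hp : 0 < p) (hq : 0 < q) :
    Fpv m q p = m / 2 * (q⁻¹ ^ 3 / (q⁻¹ ^ 2 + p⁻¹ ^ 2)) := by
  unfold Fpv
  field_simp
  ring

theorem Fpv_eq_right (m : ℝ) {p q : ℝ} (hp : 0 < p) (hq : 0 < q) :
    Fpv m p q = m / 2 * (p⁻¹ ^ 3 / (q⁻¹ ^ 2 + p⁻¹ ^ 2)) := by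
  rw [Fpv_eq_left m hq hp, add_comm]

theorem abs_cube_div_sub_le {y y' X X' M μ : ℝ} (hy : 0 ≤ y) (hy' : 0 ≤ y') (hyM : y ≤ M)
    (hyM' : y' ≤ M) (hμ : 0 < μ) (hX : μ ≤ X) (hX' : μ ≤ X') :
    |y ^ 3 / X - y' ^ 3 / X'| ≤ 3 * M ^ 2 / μ * |y - y'| + M ^ 3 / μ ^ 2 * |X - X'| := by
  have hX0 : 0 < X := hμ.trans_le hX
  have hX0' : 0 < X' := hμ.trans_le hX'
  have hM : 0 ≤ M := hy.trans hyM
  have h : y ^ 3 / X - y' ^ 3 / X' =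
      (y ^ 2 + y * y' + y' ^ 2) / X * (y - y') + -(y' ^ 3 / (X * X')) * (X - X') := by
    field_simp
    ring
  rw [h]
  refine (abs_add_le _ _).trans ?_
  rw [abs_mul, abs_mul, abs_neg, abs_of_nonneg (by positivity : 0 ≤ (y ^ 2 + y * y' + y' ^ 2) / X),
    abs_of_nonneg (by positivity : 0 ≤ y' ^ 3 / (X * X'))]
  gcongr
  · calc y ^ 2 + y * y' + y' ^ 2 ≤ M ^ 2 + M * M + M ^ 2 := by gcongr
      _ = 3 * M ^ 2 := by ring
  · calc μ ^ 2 = μ * μ := by ring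
      _ ≤ X * X' := by gcongr

theorem abs_inv_sub_inv_le {x y c : ℝ} (hc : 0 < c) (hx : c ≤ x) (hy : c ≤ y) :
    |x⁻¹ - y⁻¹| ≤ |x - y| / c ^ 2 := by
  have hx0 : 0 < x := hc.trans_le hx
  have hy0 : 0 < y := hc.trans_le hy
  have h : x⁻¹ - y⁻¹ = (y - x) / (x * y) := by field_simp
  rw [h, abs_div, abs_of_pos (mul_pos hx0 hy0), abs_sub_comm]
  gcongr
  calc c ^ 2 = c * c := by ring
    _ ≤ x * y := by gcongr

theorem abs_sub_le_of_sq {x y c : ℝ} (hc : 0 < c) (hx : c ≤ x) (hy : c ≤ y) :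
    |x - y| ≤ |x ^ 2 - y ^ 2| / c := by
  rw [le_div_iff₀ hc, show x ^ 2 - y ^ 2 = (x - y) * (x + y) by ring, abs_mul]
  gcongr
  rw [abs_of_pos (by linarith)]
  linarith

theorem arctan_cot {x : ℝ} (h0 : 0 < x) (hπ : x < π) : Real.arctan (Real.cot x) = π / 2 - x := by
  rw [← Real.arctan_tan (x := π / 2 - x) (by linarith) (by linarith), Real.tan_pi_div_two_sub,
    Real.cot_eq_cos_div_sin, Real.tan_eq_sin_div_cos, inv_div]

theorem thetaF_zero {m qinf ϑ₀ : ℝ} (hϑ : ϑ₀ ∈ Ioo (0 : ℝ) (π / 2)) :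
    thetaF m qinf ϑ₀ 0 = ϑ₀ := by
  have h := arctan_cot (x := 2 * ϑ₀) (by linarith [hϑ.1]) (by linarith [hϑ.2])
  simp only [thetaF, arccotR, mul_zero, zero_div, add_zero, h]
  ring

theorem thetaF_mem_Ioo (m qinf ϑ₀ t : ℝ) : thetaF m qinf ϑ₀ t ∈ Ioo 0 (π / 2) := by
  simp only [thetaF, arccotR]
  have h1 := Real.arctan_lt_pi_div_two (Real.cot (2 * ϑ₀) + m * t / (4 * qinf ^ 2))
  have h2 := Real.neg_pi_div_two_lt_arctan (Real.cot (2 * ϑ₀) + m * t / (4 * qinf ^ 2))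
  constructor <;> linarith

theorem thetaF_le {m qinf ϑ₀ t : ℝ} (hm : 0 < m) (hϑ : ϑ₀ ∈ Ioo (0 : ℝ) (π / 2)) (ht : 0 ≤ t) :
    thetaF m qinf ϑ₀ t ≤ ϑ₀ := by
  refine le_of_le_of_eq ?_ (thetaF_zero (m := m) (qinf := qinf) hϑ)
  simp only [thetaF, arccotR, mul_zero, zero_div, add_zero]
  have : Real.arctan (Real.cot (2 * ϑ₀)) ≤
      Real.arctan (Real.cot (2 * ϑ₀) + m * t / (4 * qinf ^ 2)) := by
    apply Real.arctan_strictMono.monotone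
    have : 0 ≤ m * t / (4 * qinf ^ 2) := by positivity
    linarith
  linarith

theorem hasDerivAt_thetaF (m qinf ϑ₀ t : ℝ) :
    HasDerivAt (thetaF m qinf ϑ₀)
      (-(m / (2 * qinf ^ 2)) * (Real.sin (thetaF m qinf ϑ₀ t) * Real.cos (thetaF m qinf ϑ₀ t)) ^ 2)
      t := by
  set x : ℝ := Real.cot (2 * ϑ₀) + m * t / (4 * qinf ^ 2) with hx
  have h1 : HasDerivAt (fun t => Real.cot (2 * ϑ₀) + m * t / (4 * qinf ^ 2))
      (m / (4 * qinf ^ 2)) t := by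
    simpa using (((hasDerivAt_id t).const_mul m).div_const (4 * qinf ^ 2)).const_add
      (Real.cot (2 * ϑ₀))
  have h2 := ((h1.arctan).const_sub (π / 2)).const_mul (1 / 2)
  refine h2.congr_deriv ?_
  have h3 : (Real.sin (thetaF m qinf ϑ₀ t) * Real.cos (thetaF m qinf ϑ₀ t)) ^ 2 =
      (1 / 4) * (1 / (1 + x ^ 2)) := by
    have h4 : 2 * thetaF m qinf ϑ₀ t = π / 2 - Real.arctan x := by
      simp only [thetaF, arccotR, hx]; ring
    have h5 := Real.sin_two_mul (thetaF m qinf ϑ₀ t)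
    rw [h4, Real.sin_pi_div_two_sub] at h5
    rw [← Real.cos_sq_arctan, h5]
    ring
  rw [h3]
  ring

theorem hasDerivAt_pstarF {m qinf ϑ₀ : ℝ} (hq : 0 < qinf) (t : ℝ) :
    HasDerivAt (pstarF m qinf ϑ₀)
      (m / 2 * ((qstarF m qinf ϑ₀ t)⁻¹ ^ 3 / qinf⁻¹ ^ 2)) t := by
  have hθ := thetaF_mem_Ioo m qinf ϑ₀ t
  have hs : 0 < Real.sin (thetaF m qinf ϑ₀ t) :=
    Real.sin_pos_of_pos_of_lt_pi hθ.1 (by linarith [hθ.2, Real.pi_pos])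
  refine (((hasDerivAt_thetaF m qinf ϑ₀ t).sin.fun_inv hs.ne').const_mul qinf).congr_deriv ?_
  simp only [qstarF]
  field_simp

theorem hasDerivAt_qstarF {m qinf ϑ₀ : ℝ} (hq : 0 < qinf) (t : ℝ) :
    HasDerivAt (qstarF m qinf ϑ₀)
      (-(m / 2 * ((pstarF m qinf ϑ₀ t)⁻¹ ^ 3 / qinf⁻¹ ^ 2))) t := by
  have hθ := thetaF_mem_Ioo m qinf ϑ₀ t
  have hs : 0 < Real.cos (thetaF m qinf ϑ₀ t) :=
    Real.cos_pos_of_mem_Ioo ⟨by linarith [hθ.1, Real.pi_pos], hθ.2⟩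
  refine (((hasDerivAt_thetaF m qinf ϑ₀ t).cos.fun_inv hs.ne').const_mul qinf).congr_deriv ?_
  simp only [pstarF]
  field_simp

theorem pstarF_pos {m qinf ϑ₀ : ℝ} (hq : 0 < qinf) (t : ℝ) : 0 < pstarF m qinf ϑ₀ t := by
  have hθ := thetaF_mem_Ioo m qinf ϑ₀ t
  exact div_pos hq (Real.sin_pos_of_pos_of_lt_pi hθ.1 (by linarith [hθ.2, Real.pi_pos]))

theorem qstarF_pos {m qinf ϑ₀ : ℝ} (hq : 0 < qinf) (t : ℝ) : 0 < qstarF m qinf ϑ₀ t := by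
  have hθ := thetaF_mem_Ioo m qinf ϑ₀ t
  exact div_pos hq (Real.cos_pos_of_mem_Ioo ⟨by linarith [hθ.1, Real.pi_pos], hθ.2⟩)

theorem inv_qstarF_sq_add_inv_pstarF_sq (m qinf ϑ₀ t : ℝ) :
    (qstarF m qinf ϑ₀ t)⁻¹ ^ 2 + (pstarF m qinf ϑ₀ t)⁻¹ ^ 2 = qinf⁻¹ ^ 2 := by
  simp only [pstarF, qstarF, inv_div, div_pow, ← add_div, Real.cos_sq_add_sin_sq, inv_pow,
    one_div]

theorem qstarF_le_qstarF_zero {m qinf ϑ₀ t : ℝ} (hm : 0 < m) (hq : 0 < qinf)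
    (hϑ : ϑ₀ ∈ Ioo (0 : ℝ) (π / 2)) (ht : 0 ≤ t) :
    qstarF m qinf ϑ₀ t ≤ qstarF m qinf ϑ₀ 0 := by
  have h1 := thetaF_mem_Ioo m qinf ϑ₀ t
  have h2 := thetaF_le (qinf := qinf) hm hϑ ht
  have h3 : Real.cos ϑ₀ ≤ Real.cos (thetaF m qinf ϑ₀ t) :=
    Real.cos_le_cos_of_nonneg_of_le_pi h1.1.le (by linarith [hϑ.2, Real.pi_pos]) h2
  have h4 : 0 < Real.cos ϑ₀ := Real.cos_pos_of_mem_Ioo ⟨by linarith [hϑ.1, Real.pi_pos], hϑ.2⟩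
  simp only [qstarF, thetaF_zero hϑ]
  gcongr

theorem pstarF_zero_add_le {m qinf ϑ₀ t : ℝ} (hm : 0 < m) (hq : 0 < qinf)
    (hϑ : ϑ₀ ∈ Ioo (0 : ℝ) (π / 2)) (ht : 0 ≤ t) :
    pstarF m qinf ϑ₀ 0 + m / 2 * ((qstarF m qinf ϑ₀ 0)⁻¹ ^ 3 / qinf⁻¹ ^ 2) * t ≤
      pstarF m qinf ϑ₀ t := by
  have h := (convex_Ici (0 : ℝ)).mul_sub_le_image_sub_of_le_deriv
    (f := pstarF m qinf ϑ₀) (C := m / 2 * ((qstarF m qinf ϑ₀ 0)⁻¹ ^ 3 / qinf⁻¹ ^ 2))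
    (fun x _ => (hasDerivAt_pstarF hq x).continuousAt.continuousWithinAt)
    (fun x _ => (hasDerivAt_pstarF hq x).differentiableAt.differentiableWithinAt)
    (fun x hx => by
      rw [(hasDerivAt_pstarF hq x).deriv]
      rw [interior_Ici] at hx
      have := qstarF_le_qstarF_zero hm hq hϑ (le_of_lt hx)
      have := qstarF_pos (m := m) (ϑ₀ := ϑ₀) hq x
      have := qstarF_pos (m := m) (ϑ₀ := ϑ₀) hq 0
      gcongr) 0 (mem_Ici.2 le_rfl) t ht ht
  linarith

/-- Data describing the orbit of the perturbed system through `p₀` in terms of `u = q⁻²` and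
`s = p⁻²`: the orbit is the curve `u + s = E u`, or `u = U s`, and along it the coordinate `p`
moves with speed `H p`, the time and position functions being `T` and `P`. -/
structure PerturbedFlow (m a u₀ p₀ K η h₀ h₁ : ℝ) (G : ℝ → ℝ) where
  E : ℝ → ℝ
  e : ℝ → ℝ
  U : ℝ → ℝ
  H : ℝ → ℝ
  T : ℝ → ℝ
  P : ℝ → ℝ
  hasDerivAt_E : ∀ u, HasDerivAt E (e u) u
  E_self : E a = a
  abs_e_le : ∀ u, |e u| ≤ 1 / 4
  e_eq : ∀ u ∈ Icc u₀ (2 * a), e u = E u * (-(2 / m) * G u / √u ^ 3)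
  abs_E_sub_le : ∀ u, |E u - a| ≤ K * η * |u - a|
  mul_le_quarter : K * η ≤ 1 / 4
  two_mul_le : 2 * (K * η) * a ≤ u₀
  E_U : ∀ s, E (U s) - U s = s
  U_E : ∀ u, U (E u - u) = u
  hasDerivAt_U : ∀ s, HasDerivAt U (e (U s) - 1)⁻¹ s
  H_eq : ∀ p, p₀ / 2 ≤ p → U (p⁻¹ ^ 2) ∈ Icc u₀ (2 * a) →
    H p = m / 2 * (√(U (p⁻¹ ^ 2)) ^ 3 / (U (p⁻¹ ^ 2) + p⁻¹ ^ 2)) + G (U (p⁻¹ ^ 2))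
  le_H : ∀ p, h₀ ≤ H p
  H_le : ∀ p, H p ≤ h₁
  hasDerivAt_T : ∀ p, HasDerivAt T (H p)⁻¹ p
  hasDerivAt_P : ∀ t, HasDerivAt P (H (P t)) t
  P_T : ∀ p, P (T p) = p
  T_P : ∀ t, T (P t) = t
  P_zero : P 0 = p₀

theorem exists_perturbedFlow {m a u₀ p₀ : ℝ} (hm : 0 < m) (ha : 0 < a) (hu₀ : 0 < u₀)
    (hu₀a : u₀ ≤ a) (hp₀ : 0 < p₀) :
    ∃ K > 0, ∃ h₀ > 0, ∃ h₁ > 0, ∃ η₀ > 0, ∀ η, η ≤ η₀ → ∀ G : ℝ → ℝ, Continuous G →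
      (∀ u, |G u| ≤ η) → Nonempty (PerturbedFlow m a u₀ p₀ K η h₀ h₁ G) := by
  have hsu₀ : 0 < √u₀ := Real.sqrt_pos.2 hu₀
  set B : ℝ := 2 / m / √u₀ ^ 3 with hB
  have hB0 : 0 < B := by positivity
  set S : ℝ := (p₀ / 2)⁻¹ ^ 2 with hS
  have hS0 : 0 < S := by positivity
  set w : ℝ := m / 2 * (√u₀ ^ 3 / (2 * a + S)) with hw
  have hw0 : 0 < w := by positivity
  set K : ℝ := 2 * a * B with hK
  have hK0 : 0 < K := by positivity
  refine ⟨K, hK0, w / 2, by positivity, m / 2 * (√(2 * a) ^ 3 / u₀) + w, by positivity,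
    min (w / 2) (min (1 / (4 * K)) (u₀ / (2 * K * a))), by positivity, ?_⟩
  intro η hη G hG hGη
  have hηw : η ≤ w / 2 := hη.trans (min_le_left _ _)
  have hη1 : K * η ≤ 1 / 4 := by
    have := hη.trans ((min_le_right _ _).trans (min_le_left _ _))
    rw [le_div_iff₀ (by positivity)] at this
    linarith
  have hη2 : 2 * (K * η) * a ≤ u₀ := by
    have := hη.trans ((min_le_right _ _).trans (min_le_right _ _))
    rw [le_div_iff₀ (by positivity)] at this
    linarith
  have hη0 : 0 ≤ η := (abs_nonneg _).trans (hGη 0)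
  set κ : ℝ → ℝ := fun u => max u₀ (min u (2 * a)) with hκ
  have hκc : Continuous κ := by fun_prop
  have hκl : ∀ u, u₀ ≤ κ u := fun u => le_max_left _ _
  have hκr : ∀ u, κ u ≤ 2 * a := fun u => max_le (by linarith) (min_le_right _ _)
  have hκu : ∀ x ∈ Icc u₀ (2 * a), κ x = x := fun x hx => by
    simp [hκ, min_eq_left hx.2, max_eq_right hx.1]
  have hκs : ∀ u, √u₀ ≤ √(κ u) := fun u => Real.sqrt_le_sqrt (hκl u)
  set b : ℝ → ℝ := fun u => -(2 / m) * G u / √(κ u) ^ 3 with hb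
  have hbc : Continuous b := by
    refine (hG.const_mul _).div (by fun_prop) fun u => ?_
    exact pow_ne_zero _ (hsu₀.trans_le (hκs u)).ne'
  have hbβ : ∀ u, |b u| ≤ B * η := fun u => by
    have h1 := hκs u
    have h2 := hGη u
    have h3 : 0 < √(κ u) := hsu₀.trans_le h1
    rw [hb]
    simp only [abs_div, abs_mul, abs_neg, abs_of_pos hm, abs_two, abs_of_pos (pow_pos h3 3)]
    calc 2 / m * |G u| / √(κ u) ^ 3 ≤ 2 / m * η / √u₀ ^ 3 := by gcongr
      _ = B * η := by rw [hB]; ring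
  obtain ⟨E, e, hE, hec, heb, hEa, heE⟩ := exists_extended_exponential ha hu₀ hu₀a hbc hbβ
    (by rw [hK] at hη1; linarith)
  have heK : ∀ u, |e u| ≤ K * η := fun u => (heb u).trans_eq (by rw [hK]; ring)
  have he4 : ∀ u, |e u| ≤ 1 / 4 := fun u => (heK u).trans hη1
  obtain ⟨V, hV1, hV2, hV3⟩ := exists_inverse_of_le_hasDerivAt (f := fun u => u - E u)
    (f' := fun u => 1 - e u) (c := 3 / 4) (by norm_num)
    (fun u => (hasDerivAt_id u).sub (hE u)) (fun u => by linarith [(abs_le.1 (he4 u)).2])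
  set U : ℝ → ℝ := fun s => V (-s) with hU
  have hUd : ∀ s, HasDerivAt U (e (U s) - 1)⁻¹ s := fun s => by
    have h := (hV3 (-s)).scomp s (hasDerivAt_neg s)
    refine h.congr_deriv ?_
    rw [← neg_sub, inv_neg, hU]
    simp
  have hUc : Continuous U := continuous_iff_continuousAt.2 fun x => (hUd x).continuousAt
  set σ : ℝ → ℝ := fun p => (max p (p₀ / 2))⁻¹ ^ 2 with hσ
  have hmax : ∀ p, p₀ / 2 ≤ max p (p₀ / 2) := fun p => le_max_right _ _
  have hσc : Continuous σ := by
    refine Continuous.pow (Continuous.inv₀ (by fun_prop) fun p => ?_) 2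
    exact ((half_pos hp₀).trans_le (hmax p)).ne'
  have hσ0 : ∀ p, 0 ≤ σ p := fun p => by positivity
  have hσS : ∀ p, σ p ≤ S := fun p => by
    have := hmax p
    rw [hS, hσ]
    dsimp only
    gcongr
  set H : ℝ → ℝ := fun p =>
    m / 2 * (√(κ (U (σ p))) ^ 3 / (κ (U (σ p)) + σ p)) + G (U (σ p)) with hH
  have hHc : Continuous H := by
    refine Continuous.add (Continuous.const_mul (Continuous.div (by fun_prop) (by fun_prop)
      fun p => ?_) _) (by fun_prop)
    exact (by linarith [hκl (U (σ p)), hσ0 p] : 0 < κ (U (σ p)) + σ p).ne'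
  have hHl : ∀ p, w / 2 ≤ H p := fun p => by
    have h1 := (abs_le.1 (hGη (U (σ p)))).1
    have h2 : w ≤ m / 2 * (√(κ (U (σ p))) ^ 3 / (κ (U (σ p)) + σ p)) := by
      have := hκs (U (σ p))
      have := hκr (U (σ p))
      have := hσS p
      have : 0 < κ (U (σ p)) + σ p := by linarith [hκl (U (σ p)), hσ0 p]
      rw [hw]
      gcongr
    rw [hH]
    dsimp only
    linarith
  have hHr : ∀ p, H p ≤ m / 2 * (√(2 * a) ^ 3 / u₀) + w := fun p => by
    have h1 := (abs_le.1 (hGη (U (σ p)))).2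
    have h2 : m / 2 * (√(κ (U (σ p))) ^ 3 / (κ (U (σ p)) + σ p)) ≤
        m / 2 * (√(2 * a) ^ 3 / u₀) := by
      have := Real.sqrt_le_sqrt (hκr (U (σ p)))
      have : u₀ ≤ κ (U (σ p)) + σ p := by linarith [hκl (U (σ p)), hσ0 p]
      gcongr
    rw [hH]
    dsimp only
    linarith
  obtain ⟨T, P, hT, hP, hPT, hTP, hP0⟩ :=
    exists_flow_of_pos_speed (half_pos hw0) hHc hHl hHr p₀
  refine ⟨⟨E, e, U, H, T, P, hE, hEa, he4, fun u hu => ?_, fun u => ?_, hη1, hη2, fun s => ?_,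
    fun u => ?_, hUd, fun p hp hpU => ?_, hHl, hHr, hT, hP, hPT, hTP, hP0⟩⟩
  · rw [heE u hu, hb]
    simp only [hκu u hu]
  · have := abs_sub_le_of_hasDerivAt hE heK a u
    rwa [hEa] at this
  · have := hV1 (-s)
    simp only [hU]
    linarith
  · have := hV2 u
    simp only [hU, neg_sub]
    exact this
  · have h1 : σ p = p⁻¹ ^ 2 := by
      simp only [hσ, max_eq_left hp]
    simp only [hH, h1, hκu _ hpU]

namespace PerturbedFlow

variable {m a u₀ p₀ K η h₀ h₁ : ℝ} {G : ℝ → ℝ}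

theorem abs_U_sub_le (F : PerturbedFlow m a u₀ p₀ K η h₀ h₁ G) {s : ℝ} (hs : 0 ≤ s) :
    |F.U s - a| ≤ 2 * s := by
  have h1 := F.E_U s
  have h2 := F.abs_E_sub_le (F.U s)
  have h3 : |F.E (F.U s) - a| ≤ 1 / 4 * |F.U s - a| :=
    h2.trans (mul_le_mul_of_nonneg_right F.mul_le_quarter (abs_nonneg _))
  have h4 : F.U s - a = (F.E (F.U s) - a) - s := by linarith
  have h5 : |F.U s - a| ≤ |F.E (F.U s) - a| + s := by
    calc |F.U s - a| = |(F.E (F.U s) - a) - s| := by rw [← h4]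
      _ ≤ |F.E (F.U s) - a| + |s| := abs_sub _ _
      _ = |F.E (F.U s) - a| + s := by rw [abs_of_nonneg hs]
  linarith

theorem abs_U_add_sub_le (F : PerturbedFlow m a u₀ p₀ K η h₀ h₁ G) (hKη : 0 ≤ K * η) {s : ℝ}
    (hs : 0 ≤ s) : |F.U s + s - a| ≤ 2 * (K * η) * s := by
  have h1 := F.E_U s
  have h2 := F.abs_E_sub_le (F.U s)
  have h3 : F.U s + s = F.E (F.U s) := by linarith
  rw [h3]
  refine h2.trans ((mul_le_mul_of_nonneg_left (F.abs_U_sub_le hs) hKη).trans_eq (by ring))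

theorem U_mem_Icc (F : PerturbedFlow m a u₀ p₀ K η h₀ h₁ G) (hKη : 0 ≤ K * η) (hu₀ : 0 < u₀)
    {s : ℝ} (hs : 0 ≤ s) (hsa : s ≤ a - 2 * u₀) : F.U s ∈ Icc u₀ (2 * a) := by
  have h1 := abs_le.1 (F.abs_U_add_sub_le hKη hs)
  have h2 : 2 * (K * η) * s ≤ u₀ :=
    (mul_le_mul_of_nonneg_left (by linarith) (by linarith)).trans F.two_mul_le
  constructor <;> linarith [h1.1, h1.2]

theorem le_P (F : PerturbedFlow m a u₀ p₀ K η h₀ h₁ G) {t : ℝ} (ht : 0 ≤ t) :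
    p₀ + h₀ * t ≤ F.P t := by
  have h := mul_sub_le_of_le_hasDerivAt F.hasDerivAt_P (fun t => F.le_H (F.P t)) ht
  rw [F.P_zero] at h
  linarith

theorem inv_P_sq_le (F : PerturbedFlow m a u₀ p₀ K η h₀ h₁ G) (hp₀ : 0 < p₀) (hh₀ : 0 < h₀)
    (hp₀a : p₀⁻¹ ^ 2 = a - 2 * u₀) {t : ℝ} (ht : 0 ≤ t) : (F.P t)⁻¹ ^ 2 ≤ a - 2 * u₀ := by
  have h1 := F.le_P ht
  have h2 : p₀ ≤ F.P t := by nlinarith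
  have h3 : 0 < F.P t := hp₀.trans_le h2
  rw [← hp₀a]
  gcongr

/-- The second component of the perturbed trajectory. -/
def Q (F : PerturbedFlow m a u₀ p₀ K η h₀ h₁ G) (t : ℝ) : ℝ := (√(F.U ((F.P t)⁻¹ ^ 2)))⁻¹

theorem hasDerivAt_P_Fpv (F : PerturbedFlow m a u₀ p₀ K η h₀ h₁ G) (hKη : 0 ≤ K * η)
    (hu₀ : 0 < u₀) (hp₀ : 0 < p₀) (hh₀ : 0 < h₀) (hp₀a : p₀⁻¹ ^ 2 = a - 2 * u₀) {t : ℝ}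
    (ht : 0 ≤ t) :
    HasDerivAt F.P (Fpv m (F.Q t) (F.P t) + G (F.U ((F.P t)⁻¹ ^ 2))) t := by
  have hU := F.U_mem_Icc hKη hu₀ (sq_nonneg (F.P t)⁻¹) (F.inv_P_sq_le hp₀ hh₀ hp₀a ht)
  have hP : p₀ ≤ F.P t := by nlinarith [F.le_P ht]
  have hu : 0 < F.U ((F.P t)⁻¹ ^ 2) := hu₀.trans_le hU.1
  refine (F.hasDerivAt_P t).congr_deriv ?_
  rw [F.H_eq _ (by linarith) hU, Fpv_eq_left m (hp₀.trans_le hP)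
    (show 0 < F.Q t from inv_pos.2 (Real.sqrt_pos.2 hu)), Q, inv_inv, Real.sq_sqrt hu.le]

theorem hasDerivAt_Q_Fpv (F : PerturbedFlow m a u₀ p₀ K η h₀ h₁ G) (hm : 0 < m) (hKη : 0 ≤ K * η)
    (hu₀ : 0 < u₀) (hp₀ : 0 < p₀) (hh₀ : 0 < h₀) (hp₀a : p₀⁻¹ ^ 2 = a - 2 * u₀) {t : ℝ}
    (ht : 0 ≤ t) : HasDerivAt F.Q (-Fpv m (F.P t) (F.Q t)) t := by
  have hU := F.U_mem_Icc hKη hu₀ (sq_nonneg (F.P t)⁻¹) (F.inv_P_sq_le hp₀ hh₀ hp₀a ht)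
  have hP : 0 < F.P t := hp₀.trans_le (by nlinarith [F.le_P ht])
  have hP' := F.hasDerivAt_P_Fpv hKη hu₀ hp₀ hh₀ hp₀a ht
  have hE := F.E_U ((F.P t)⁻¹ ^ 2)
  have he := F.e_eq _ hU
  have he4 := F.abs_e_le (F.U ((F.P t)⁻¹ ^ 2))
  have hu : 0 < F.U ((F.P t)⁻¹ ^ 2) := hu₀.trans_le hU.1
  have hq : 0 < F.Q t := inv_pos.2 (Real.sqrt_pos.2 hu)
  have hd := (((F.hasDerivAt_U _).comp t ((hP'.fun_inv hP.ne').fun_pow 2)).sqrt hu.ne').fun_inv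
    (Real.sqrt_pos.2 hu).ne'
  refine hd.congr_deriv ?_
  rw [Fpv_eq_right m hP hq, Fpv_eq_left m hP hq]
  simp only [Function.comp_apply, Q, inv_inv]
  have hne : F.e (F.U ((F.P t)⁻¹ ^ 2)) - 1 ≠ 0 := by
    have := (abs_le.1 he4).2
    linarith
  have hEs : F.E (F.U ((F.P t)⁻¹ ^ 2)) = F.U ((F.P t)⁻¹ ^ 2) + (F.P t)⁻¹ ^ 2 := by linarith
  rw [hEs] at he
  set u := F.U ((F.P t)⁻¹ ^ 2) with hudef
  set z := (F.P t)⁻¹ with hz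
  have hz0 : 0 < z := inv_pos.2 hP
  set e := F.e u with hedef
  obtain ⟨y, hy, hyu⟩ : ∃ y, 0 < y ∧ √u = y := ⟨_, Real.sqrt_pos.2 hu, rfl⟩
  have hu2 : u = y ^ 2 := by rw [← hyu, Real.sq_sqrt hu.le]
  have hPz : F.P t = z⁻¹ := by rw [hz, inv_inv]
  rw [hyu] at he ⊢
  rw [hPz]
  have hs : 0 < u + z ^ 2 := by positivity
  have key : m / 2 * (y ^ 3 / (y ^ 2 + z ^ 2)) + G u =
      -(m / 2 * (y ^ 3 / (u + z ^ 2))) * (e - 1) := by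
    rw [he]
    rw [hu2] at hs ⊢
    field_simp
    ring
  rw [key]
  rw [hu2] at hs ⊢
  field_simp
  ring

/-- Every solution with the right asymptotics which stays in the region described by `F` is the
trajectory of `F`. -/
theorem eq_P_and_eq_Q (F : PerturbedFlow m a u₀ p₀ K η h₀ h₁ G) (hm : 0 < m) (ha : 0 < a)
    (hu₀ : 0 < u₀) (hp₀ : 0 < p₀) (hh₀ : 0 < h₀) {p q : ℝ → ℝ} {r : ℝ} (hr : 0 < r)
    (hra : a = r⁻¹ ^ 2) (hp0 : p 0 = p₀) (hp : ∀ t, 0 ≤ t → p₀ / 2 ≤ p t)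
    (hptop : Tendsto p atTop atTop) (hq : ∀ t, 0 ≤ t → 0 < q t)
    (hqu : ∀ t, 0 ≤ t → (q t)⁻¹ ^ 2 ∈ Icc u₀ (2 * a)) (hqr : Tendsto q atTop (𝓝 r))
    (hdp : ∀ t, 0 ≤ t → HasDerivAt p (Fpv m (q t) (p t) + G ((q t)⁻¹ ^ 2)) t)
    (hdq : ∀ t, 0 ≤ t → HasDerivAt q (-Fpv m (p t) (q t)) t) {t : ℝ} (ht : 0 ≤ t) :
    p t = F.P t ∧ q t = F.Q t := by
  have hEpos : ∀ u ∈ Icc u₀ (2 * a), 0 < F.E u := fun u hu => by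
    have h1 := (F.abs_E_sub_le u).trans
      (mul_le_mul_of_nonneg_right F.mul_le_quarter (abs_nonneg _))
    have h2 : |u - a| ≤ a := abs_le.2 ⟨by linarith [hu.1], by linarith [hu.2]⟩
    have := (abs_le.1 h1).1
    linarith
  set N : ℝ → ℝ := fun t => ((q t)⁻¹ ^ 2 + (p t)⁻¹ ^ 2) / F.E ((q t)⁻¹ ^ 2) with hN
  have hNd : ∀ t, 0 ≤ t → HasDerivAt N 0 t := fun t ht => by
    have hpt : 0 < p t := (half_pos hp₀).trans_le (hp t ht)
    have hqt := hq t ht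
    have hE := hEpos _ (hqu t ht)
    have hu := ((hdq t ht).fun_inv hqt.ne').fun_pow 2
    have hs := ((hdp t ht).fun_inv hpt.ne').fun_pow 2
    have h := (hu.fun_add hs).fun_div ((F.hasDerivAt_E _).comp t hu) hE.ne'
    refine h.congr_deriv ?_
    have he := F.e_eq _ (hqu t ht)
    rw [Real.sqrt_sq (inv_pos.2 hqt).le] at he
    rw [he, Fpv_eq_right m hpt hqt, Fpv_eq_left m hpt hqt]
    simp only [Function.comp_apply, Nat.cast_ofNat, show 2 - 1 = 1 from rfl, pow_one]
    set X := F.E ((q t)⁻¹ ^ 2)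
    set g := G ((q t)⁻¹ ^ 2)
    field_simp
    ring
  have hNlim : Tendsto N atTop (𝓝 1) := by
    have h1 : Tendsto (fun t => (q t)⁻¹ ^ 2) atTop (𝓝 a) := by
      rw [hra]
      exact (hqr.inv₀ hr.ne').pow 2
    have h2 : Tendsto (fun t => (p t)⁻¹ ^ 2) atTop (𝓝 0) := by
      have := (tendsto_inv_atTop_zero.comp hptop).pow 2
      simpa using this
    have h3 : Tendsto (fun t => F.E ((q t)⁻¹ ^ 2)) atTop (𝓝 a) := by
      have := (F.hasDerivAt_E a).continuousAt.tendsto.comp h1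
      rwa [F.E_self] at this
    have := (h1.add h2).div h3 ha.ne'
    rwa [add_zero, div_self ha.ne'] at this
  have hN1 : ∀ t, 0 ≤ t → N t = 1 := fun t ht => by
    rw [eq_of_hasDerivAt_zero_of_nonneg hNd ht]
    refine tendsto_nhds_unique (tendsto_const_nhds.congr' ?_) hNlim
    filter_upwards [eventually_ge_atTop (0 : ℝ)] with t ht
    exact (eq_of_hasDerivAt_zero_of_nonneg hNd ht).symm
  have hU : ∀ t, 0 ≤ t → F.U ((p t)⁻¹ ^ 2) = (q t)⁻¹ ^ 2 := fun t ht => by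
    have h1 := hN1 t ht
    rw [hN] at h1
    dsimp only at h1
    rw [div_eq_one_iff_eq (hEpos _ (hqu t ht)).ne'] at h1
    have h2 := F.U_E ((q t)⁻¹ ^ 2)
    rwa [← h1, add_sub_cancel_left] at h2
  have hT : ∀ t, 0 ≤ t → HasDerivAt (fun t => F.T (p t) - t) 0 t := fun t ht => by
    have h1 := ((F.hasDerivAt_T (p t)).comp t (hdp t ht)).sub (hasDerivAt_id t)
    refine h1.congr_deriv ?_
    have hpt : 0 < p t := (half_pos hp₀).trans_le (hp t ht)
    have h2 := F.H_eq (p t) (hp t ht) (by rw [hU t ht]; exact hqu t ht)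
    rw [hU t ht, Real.sqrt_sq (inv_pos.2 (hq t ht)).le] at h2
    rw [Fpv_eq_left m hpt (hq t ht), ← h2,
      inv_mul_cancel₀ (hh₀.trans_le (F.le_H (p t))).ne', sub_self]
  have h1 : F.T (p t) = t := by
    have h2 := eq_of_hasDerivAt_zero_of_nonneg hT ht
    have h3 := F.T_P 0
    rw [F.P_zero] at h3
    rw [hp0, h3] at h2
    linarith
  have h2 : p t = F.P t := by rw [← F.P_T (p t), h1]
  refine ⟨h2, ?_⟩
  rw [Q, ← h2, hU t ht, Real.sqrt_sq (inv_pos.2 (hq t ht)).le, inv_inv]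

end PerturbedFlow

/-- The properties of the explicit trajectory which are used in the perturbation argument. -/
structure IsReferenceOrbit (m a c : ℝ) (p q : ℝ → ℝ) : Prop where
  le_p : ∀ t, 0 ≤ t → c * (1 + t) ≤ p t
  p_zero_le : ∀ t, 0 ≤ t → p 0 ≤ p t
  q_pos : ∀ t, 0 ≤ t → 0 < q t
  q_le : ∀ t, 0 ≤ t → q t ≤ q 0
  add_eq : ∀ t, 0 ≤ t → (q t)⁻¹ ^ 2 + (p t)⁻¹ ^ 2 = a
  hasDerivAt_p : ∀ t, 0 ≤ t → HasDerivAt p (m / 2 * ((q t)⁻¹ ^ 3 / a)) t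
  hasDerivAt_q : ∀ t, 0 ≤ t → HasDerivAt q (-(m / 2 * ((p t)⁻¹ ^ 3 / a))) t

theorem abs_speed_sub_le {m a u₀ u X y g : ℝ} (hm : 0 < m) (ha : 0 < a) (hu₀ : 0 < u₀)
    (hu : u ∈ Icc u₀ (2 * a)) (hX : a / 2 ≤ X) (hy : √u₀ ≤ y) (hya : y ^ 2 ≤ 2 * a) :
    |m / 2 * (√u ^ 3 / X) + g - m / 2 * (y ^ 3 / a)| ≤
      m / 2 * (12 / √u₀ * |u - y ^ 2| + √(2 * a) ^ 3 / (a / 2) ^ 2 * |X - a|) + |g| := by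
  have hs : 0 < √u₀ := Real.sqrt_pos.2 hu₀
  have hy0 : 0 < y := hs.trans_le hy
  have h1 := abs_cube_div_sub_le (Real.sqrt_nonneg u) hy0.le (Real.sqrt_le_sqrt hu.2)
    (Real.le_sqrt_of_sq_le hya) (half_pos ha) hX (half_le_self ha.le)
  have h2 := abs_sub_le_of_sq hs (Real.sqrt_le_sqrt hu.1) hy
  rw [Real.sq_sqrt (hu₀.le.trans hu.1)] at h2
  have h3 : 3 * √(2 * a) ^ 2 / (a / 2) = 12 := by
    rw [Real.sq_sqrt (by positivity)]; field_simp; norm_num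
  rw [h3] at h1
  have h4 : m / 2 * (√u ^ 3 / X) + g - m / 2 * (y ^ 3 / a) =
      m / 2 * (√u ^ 3 / X - y ^ 3 / a) + g := by ring
  rw [h4]
  refine (abs_add_le _ _).trans ?_
  rw [abs_mul, abs_of_pos (half_pos hm)]
  gcongr
  refine h1.trans ?_
  have h5 : 12 * |√u - y| ≤ 12 / √u₀ * |u - y ^ 2| := by
    calc 12 * |√u - y| ≤ 12 * (|u - y ^ 2| / √u₀) := by gcongr
      _ = 12 / √u₀ * |u - y ^ 2| := by ring
  linarith

/-- The perturbed trajectory stays close to the reference trajectory, linearly in the size `η` of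
the perturbation. -/
theorem exists_perturbedFlow_estimates {m a u₀ p₀ K h₀ h₁ c : ℝ} {ps qs : ℝ → ℝ} (hm : 0 < m)
    (ha : 0 < a) (hu₀ : 0 < u₀) (hp₀ : 0 < p₀) (hK : 0 < K) (hh₀ : 0 < h₀) (hh₁ : 0 < h₁)
    (hc : 0 < c) (hR : IsReferenceOrbit m a c ps qs) (hps : ps 0 = p₀)
    (hqs : 2 * u₀ = (qs 0)⁻¹ ^ 2) :
    ∃ C > 0, ∀ (η : ℝ) (G : ℝ → ℝ) (F : PerturbedFlow m a u₀ p₀ K η h₀ h₁ G),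
      (∀ u, |G u| ≤ η) → ∀ t, 0 ≤ t →
        |F.P t - ps t| ≤ C * η * (1 + t) ∧
        |Fpv m (F.Q t) (F.P t) + G (F.U ((F.P t)⁻¹ ^ 2)) - m / 2 * ((qs t)⁻¹ ^ 3 / a)| ≤ C * η ∧
        (1 + t) ^ 2 * |F.Q t - qs t| ≤ C * η ∧
        (1 + t) ^ 3 * |-Fpv m (F.P t) (F.Q t) - -(m / 2 * ((ps t)⁻¹ ^ 3 / a))| ≤ C * η := by
  have hs : 0 < √u₀ := Real.sqrt_pos.2 hu₀
  obtain ⟨d, hd, hdc, hdp, hdh⟩ : ∃ d > 0, d ≤ c ∧ d ≤ p₀ ∧ d ≤ h₀ :=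
    ⟨min c (min p₀ h₀), by positivity, min_le_left _ _, (min_le_right _ _).trans (min_le_left _ _),
      (min_le_right _ _).trans (min_le_right _ _)⟩
  obtain ⟨A, hA⟩ : ∃ A, A = √(2 * a) ^ 3 / (a / 2) ^ 2 := ⟨_, rfl⟩
  have hA0 : 0 < A := by rw [hA]; positivity
  obtain ⟨K₂, hK₂⟩ : ∃ x, x = m / 2 * (12 / √u₀ * (2 * K * a) + A * (2 * K * a)) + 1 := ⟨_, rfl⟩
  obtain ⟨K₃, hK₃⟩ : ∃ x, x = h₁ * (K₂ / h₀) := ⟨_, rfl⟩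
  obtain ⟨K₄, hK₄⟩ : ∃ x, x = 2 * K₃ / d ^ 3 + 2 * K / d ^ 2 := ⟨_, rfl⟩
  obtain ⟨K₅, hK₅⟩ : ∃ x, x = m / 2 * (12 / √u₀ * K₄ + A * (2 * K * a)) + 1 := ⟨_, rfl⟩
  obtain ⟨K₆, hK₆⟩ : ∃ x, x = K₄ / (√u₀ * u₀) := ⟨_, rfl⟩
  obtain ⟨K₇, hK₇⟩ : ∃ x, x = m / 2 * (6 / a * (K₃ / d ^ 4) + 4 / a ^ 2 * (2 * K * a) / d ^ 3) :=
    ⟨_, rfl⟩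
  have hK₂0 : 0 < K₂ := by rw [hK₂]; positivity
  have hK₃0 : 0 < K₃ := by rw [hK₃]; positivity
  have hK₄0 : 0 < K₄ := by rw [hK₄]; positivity
  have hK₅0 : 0 < K₅ := by rw [hK₅]; positivity
  have hK₆0 : 0 < K₆ := by rw [hK₆]; positivity
  have hK₇0 : 0 < K₇ := by rw [hK₇]; positivity
  refine ⟨K₃ + K₅ + K₆ + K₇, by positivity, fun η G F hG => ?_⟩
  have hη : 0 ≤ η := (abs_nonneg _).trans (hG 0)
  have hKη : 0 ≤ K * η := by positivity
  have hps0 : ∀ t, 0 ≤ t → 0 < ps t := fun t ht => by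
    have := hR.p_zero_le t ht
    linarith
  have hp₀a : p₀⁻¹ ^ 2 = a - 2 * u₀ := by
    have := hR.add_eq 0 le_rfl
    rw [hps] at this
    linarith
  have hssle : ∀ t, 0 ≤ t → (ps t)⁻¹ ^ 2 ≤ a - 2 * u₀ := fun t ht => by
    have h1 := hR.p_zero_le t ht
    have h2 := hps0 t ht
    rw [hps] at h1
    rw [← hp₀a]
    gcongr
  have hys : ∀ t, 0 ≤ t → √u₀ ≤ (qs t)⁻¹ := fun t ht => by
    have h1 := hR.q_le t ht
    have h2 := hR.q_pos t ht
    have h3 := hR.q_pos 0 le_rfl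
    refine Real.sqrt_le_iff.2 ⟨by positivity, ?_⟩
    have h4 : (qs 0)⁻¹ ^ 2 ≤ (qs t)⁻¹ ^ 2 := by gcongr
    linarith
  have hysa : ∀ t, 0 ≤ t → (qs t)⁻¹ ^ 2 ≤ 2 * a := fun t ht => by
    have := hR.add_eq t ht
    have := sq_nonneg (ps t)⁻¹
    linarith
  have hXle : ∀ s, 0 ≤ s → s ≤ a - 2 * u₀ → |F.U s + s - a| ≤ 2 * K * a * η := fun s hs hsa => by
    refine (F.abs_U_add_sub_le hKη hs).trans ?_
    calc 2 * (K * η) * s ≤ 2 * (K * η) * a := by gcongr; linarith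
      _ = 2 * K * a * η := by ring
  have hX2 : ∀ s, 0 ≤ s → s ≤ a - 2 * u₀ → a / 2 ≤ F.U s + s := fun s hs hsa => by
    have h1 := hXle s hs hsa
    have h2 : 2 * K * a * η ≤ a / 2 := by
      calc 2 * K * a * η = 2 * a * (K * η) := by ring
        _ ≤ 2 * a * (1 / 4) := by gcongr; exact F.mul_le_quarter
        _ = a / 2 := by ring
    linarith [(abs_le.1 h1).1]
  have hspeed : ∀ t, 0 ≤ t → |F.H (ps t) - m / 2 * ((qs t)⁻¹ ^ 3 / a)| ≤ K₂ * η := fun t ht => by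
    have h0 : 0 ≤ (ps t)⁻¹ ^ 2 := sq_nonneg _
    have h1 := F.U_mem_Icc hKη hu₀ h0 (hssle t ht)
    have h2 := hXle _ h0 (hssle t ht)
    have h3 := hR.p_zero_le t ht
    rw [F.H_eq (ps t) (by linarith) h1]
    have h4 := abs_speed_sub_le (g := G (F.U ((ps t)⁻¹ ^ 2))) hm ha hu₀ h1 (hX2 _ h0 (hssle t ht))
      (hys t ht) (hysa t ht)
    have h5 : F.U ((ps t)⁻¹ ^ 2) - (qs t)⁻¹ ^ 2 = F.U ((ps t)⁻¹ ^ 2) + (ps t)⁻¹ ^ 2 - a := by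
      linarith [hR.add_eq t ht]
    rw [h5, ← hA] at h4
    refine h4.trans ?_
    calc _ ≤ m / 2 * (12 / √u₀ * (2 * K * a * η) + A * (2 * K * a * η)) + η := by
          gcongr; exact hG _
      _ = K₂ * η := by rw [hK₂]; ring
  have hdist : ∀ t, 0 ≤ t → |F.P t - ps t| ≤ K₃ * η * t := fun t ht => by
    have h1 : ∀ τ, 0 ≤ τ → HasDerivAt (fun τ => F.T (ps τ) - τ)
        ((F.H (ps τ))⁻¹ * (m / 2 * ((qs τ)⁻¹ ^ 3 / a)) - 1) τ := fun τ hτ =>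
      ((F.hasDerivAt_T (ps τ)).comp τ (hR.hasDerivAt_p τ hτ)).sub (hasDerivAt_id τ)
    have h2 := abs_sub_le_of_hasDerivAt_nonneg (C := K₂ / h₀ * η) h1 (fun τ hτ => by
      have h3 := hspeed τ hτ
      have h4 := F.le_H (ps τ)
      have h5 : 0 < F.H (ps τ) := hh₀.trans_le h4
      rw [abs_sub_comm] at h3
      have h6 : (F.H (ps τ))⁻¹ * (m / 2 * ((qs τ)⁻¹ ^ 3 / a)) - 1 =
          (m / 2 * ((qs τ)⁻¹ ^ 3 / a) - F.H (ps τ)) / F.H (ps τ) := by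
        field_simp
      rw [h6, abs_div, abs_of_pos h5]
      calc _ ≤ K₂ * η / h₀ := by gcongr
        _ = K₂ / h₀ * η := by ring) ht
    have h3 : F.T (ps 0) = 0 := by
      rw [hps]
      have := F.T_P 0
      rwa [F.P_zero] at this
    rw [h3, sub_zero, sub_zero] at h2
    have h4 := abs_sub_le_of_hasDerivAt F.hasDerivAt_P (C := h₁) (fun t => by
      rw [abs_of_pos (hh₀.trans_le (F.le_H _))]
      exact F.H_le _) t (F.T (ps t))
    rw [F.P_T, abs_sub_comm] at h4
    refine h4.trans ?_
    calc _ ≤ h₁ * (K₂ / h₀ * η * t) := by gcongr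
      _ = K₃ * η * t := by rw [hK₃]; ring
  intro t ht
  have hs0 : 0 ≤ (F.P t)⁻¹ ^ 2 := sq_nonneg _
  have hsle := F.inv_P_sq_le hp₀ hh₀ hp₀a ht
  have hU := F.U_mem_Icc hKη hu₀ hs0 hsle
  have hu : 0 < F.U ((F.P t)⁻¹ ^ 2) := hu₀.trans_le hU.1
  have hQ : 0 < F.Q t := inv_pos.2 (Real.sqrt_pos.2 hu)
  have hQinv : (F.Q t)⁻¹ = √(F.U ((F.P t)⁻¹ ^ 2)) := inv_inv _
  have hτ : 0 < 1 + t := by linarith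
  have hPd : d * (1 + t) ≤ F.P t := by
    have h1 := F.le_P ht
    have h2 : d * t ≤ h₀ * t := by gcongr
    linarith
  have hpd : d * (1 + t) ≤ ps t := by
    have h1 := hR.le_p t ht
    have h2 : d * (1 + t) ≤ c * (1 + t) := by gcongr
    linarith
  have hdt : 0 < d * (1 + t) := by positivity
  have hP : 0 < F.P t := hdt.trans_le hPd
  have hz : (F.P t)⁻¹ ≤ (d * (1 + t))⁻¹ := by gcongr
  have hzs : (ps t)⁻¹ ≤ (d * (1 + t))⁻¹ := by gcongr
  have hz0 : 0 < (F.P t)⁻¹ := inv_pos.2 hP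
  have hzs0 : 0 < (ps t)⁻¹ := inv_pos.2 (hps0 t ht)
  have hzz : |(F.P t)⁻¹ - (ps t)⁻¹| ≤ K₃ * η / (d ^ 2 * (1 + t)) := by
    refine (abs_inv_sub_inv_le hdt hPd hpd).trans ?_
    calc _ ≤ K₃ * η * (1 + t) / (d * (1 + t)) ^ 2 := by
          gcongr
          exact (hdist t ht).trans (by gcongr; linarith)
      _ = K₃ * η / (d ^ 2 * (1 + t)) := by field_simp
  have hss : |(F.P t)⁻¹ ^ 2 - (ps t)⁻¹ ^ 2| ≤ 2 * K₃ / d ^ 3 * η / (1 + t) ^ 2 := by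
    rw [sq_sub_sq, abs_mul, abs_of_pos (by positivity)]
    calc _ ≤ ((d * (1 + t))⁻¹ + (d * (1 + t))⁻¹) * (K₃ * η / (d ^ 2 * (1 + t))) := by gcongr
      _ = 2 * K₃ / d ^ 3 * η / (1 + t) ^ 2 := by field_simp; ring
  have hX : |F.U ((F.P t)⁻¹ ^ 2) + (F.P t)⁻¹ ^ 2 - a| ≤ 2 * K / d ^ 2 * η / (1 + t) ^ 2 := by
    refine (F.abs_U_add_sub_le hKη hs0).trans ?_
    calc _ ≤ 2 * (K * η) * (d * (1 + t))⁻¹ ^ 2 := by gcongr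
      _ = 2 * K / d ^ 2 * η / (1 + t) ^ 2 := by field_simp
  have huu : |F.U ((F.P t)⁻¹ ^ 2) - (qs t)⁻¹ ^ 2| ≤ K₄ * η / (1 + t) ^ 2 := by
    have h1 : F.U ((F.P t)⁻¹ ^ 2) - (qs t)⁻¹ ^ 2 =
        (F.U ((F.P t)⁻¹ ^ 2) + (F.P t)⁻¹ ^ 2 - a) - ((F.P t)⁻¹ ^ 2 - (ps t)⁻¹ ^ 2) := by
      linarith [hR.add_eq t ht]
    rw [h1]
    refine (abs_sub _ _).trans ((add_le_add hX hss).trans_eq ?_)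
    rw [hK₄]
    ring
  have hX' := hXle _ hs0 hsle
  have hXa := hX2 _ hs0 hsle
  have hmono : ∀ x, x ≤ K₃ + K₅ + K₆ + K₇ → x * η ≤ (K₃ + K₅ + K₆ + K₇) * η := fun x hx =>
    mul_le_mul_of_nonneg_right hx hη
  refine ⟨?_, ?_, ?_, ?_⟩
  · have h1 : K₃ * η ≤ (K₃ + K₅ + K₆ + K₇) * η := hmono _ (by linarith)
    refine (hdist t ht).trans ?_
    gcongr
    linarith
  · refine le_trans ?_ (hmono K₅ (by linarith))
    rw [Fpv_eq_left m hP hQ, hQinv, Real.sq_sqrt hu.le]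
    refine (abs_speed_sub_le hm ha hu₀ hU hXa (hys t ht) (hysa t ht)).trans ?_
    rw [← hA]
    have h1 : |F.U ((F.P t)⁻¹ ^ 2) - (qs t)⁻¹ ^ 2| ≤ K₄ * η := huu.trans
      (div_le_self (by positivity) (one_le_pow₀ (by linarith)))
    calc _ ≤ m / 2 * (12 / √u₀ * (K₄ * η) + A * (2 * K * a * η)) + η := by
          gcongr; exact hG _
      _ = K₅ * η := by rw [hK₅]; ring
  · refine le_trans ?_ (hmono K₆ (by linarith))
    have hy := Real.sqrt_le_sqrt hU.1
    have h1 := abs_inv_sub_inv_le hs hy (hys t ht)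
    have h2 := abs_sub_le_of_sq hs hy (hys t ht)
    rw [Real.sq_sqrt hu.le] at h2
    rw [inv_inv, Real.sq_sqrt hu₀.le] at h1
    calc (1 + t) ^ 2 * |F.Q t - qs t|
        ≤ (1 + t) ^ 2 * (K₄ * η / (1 + t) ^ 2 / √u₀ / u₀) := by
          gcongr
          refine h1.trans ?_
          gcongr
          exact h2.trans (by gcongr)
      _ = K₆ * η := by rw [hK₆]; field_simp
  · refine le_trans ?_ (hmono K₇ (by linarith))
    rw [Fpv_eq_right m hP hQ, hQinv, Real.sq_sqrt hu.le]
    have h1 := abs_cube_div_sub_le hz0.le hzs0.le hz hzs (half_pos ha) hXa (half_le_self ha.le)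
    rw [neg_sub_neg, ← mul_sub, abs_mul, abs_of_pos (half_pos hm), abs_sub_comm]
    calc _ ≤ (1 + t) ^ 3 * (m / 2 * (3 * (d * (1 + t))⁻¹ ^ 2 / (a / 2) *
            (K₃ * η / (d ^ 2 * (1 + t))) +
            (d * (1 + t))⁻¹ ^ 3 / (a / 2) ^ 2 * (2 * K * a * η))) := by
          gcongr
          refine h1.trans ?_
          gcongr
      _ = K₇ * η := by
          rw [hK₇]
          field_simp
          ring

theorem isReferenceOrbit_star {m qinf ϑ₀ : ℝ} (hm : 0 < m) (hq : 0 < qinf)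
    (hϑ : ϑ₀ ∈ Ioo (0 : ℝ) (π / 2)) :
    ∃ c > 0, IsReferenceOrbit m (qinf⁻¹ ^ 2) c (pstarF m qinf ϑ₀) (qstarF m qinf ϑ₀) := by
  have hp0 : 0 < pstarF m qinf ϑ₀ 0 := pstarF_pos hq 0
  have hq0 : 0 < qstarF m qinf ϑ₀ 0 := qstarF_pos hq 0
  set v : ℝ := m / 2 * ((qstarF m qinf ϑ₀ 0)⁻¹ ^ 3 / qinf⁻¹ ^ 2) with hv
  have hv0 : 0 < v := by positivity
  refine ⟨min (pstarF m qinf ϑ₀ 0) v, lt_min hp0 hv0, fun t ht => ?_, fun t ht => ?_,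
    fun t _ => qstarF_pos hq t, fun t ht => qstarF_le_qstarF_zero hm hq hϑ ht,
    fun t _ => inv_qstarF_sq_add_inv_pstarF_sq m qinf ϑ₀ t, fun t _ => hasDerivAt_pstarF hq t,
    fun t _ => hasDerivAt_qstarF hq t⟩
  · have h0 := pstarF_zero_add_le hm hq hϑ ht
    rw [← hv] at h0
    refine le_trans ?_ h0
    have h1 := min_le_left (pstarF m qinf ϑ₀ 0) v
    have h2 := mul_le_mul_of_nonneg_right (min_le_right (pstarF m qinf ϑ₀ 0) v) ht
    linarith
  · have h0 := pstarF_zero_add_le hm hq hϑ ht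
    rw [← hv] at h0
    refine le_trans ?_ h0
    have := mul_nonneg hv0.le ht
    linarith

namespace IsReferenceOrbit

variable {m r c : ℝ} {ps qs : ℝ → ℝ}

theorem le_q (h : IsReferenceOrbit m (r⁻¹ ^ 2) c ps qs) (hr : 0 < r) {t : ℝ} (ht : 0 ≤ t) :
    r ≤ qs t := by
  have h1 : (qs t)⁻¹ ^ 2 ≤ r⁻¹ ^ 2 := by
    have := h.add_eq t ht
    have := sq_nonneg (ps t)⁻¹
    linarith
  have h2 := (sq_le_sq₀ (inv_pos.2 (h.q_pos t ht)).le (inv_pos.2 hr).le).1 h1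
  exact (inv_le_inv₀ (h.q_pos t ht) hr).1 h2

theorem tendsto_p (h : IsReferenceOrbit m (r⁻¹ ^ 2) c ps qs) (hc : 0 < c) :
    Tendsto ps atTop atTop := by
  have h1 : Tendsto (fun t : ℝ => c * (1 + t)) atTop atTop :=
    (tendsto_atTop_add_const_left _ _ tendsto_id).const_mul_atTop hc
  refine tendsto_atTop_mono' _ ?_ h1
  filter_upwards [eventually_ge_atTop (0 : ℝ)] with t ht
  exact h.le_p t ht

theorem tendsto_q (h : IsReferenceOrbit m (r⁻¹ ^ 2) c ps qs) (hr : 0 < r) (hc : 0 < c) :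
    Tendsto qs atTop (𝓝 r) := by
  have h1 : Tendsto (fun t => (√(r⁻¹ ^ 2 - (ps t)⁻¹ ^ 2))⁻¹) atTop (𝓝 r) := by
    have h2 := (tendsto_inv_atTop_zero.comp (h.tendsto_p hc)).pow 2
    have h3 := ((tendsto_const_nhds (x := r⁻¹ ^ 2)).sub h2).sqrt.inv₀ (by
      rw [zero_pow two_ne_zero, sub_zero, Real.sqrt_sq (inv_pos.2 hr).le]
      exact (inv_pos.2 hr).ne')
    rwa [zero_pow two_ne_zero, sub_zero, Real.sqrt_sq (inv_pos.2 hr).le, inv_inv] at h3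
  refine h1.congr' ?_
  filter_upwards [eventually_ge_atTop (0 : ℝ)] with t ht
  rw [← h.add_eq t ht, add_sub_cancel_right, Real.sqrt_sq (inv_pos.2 (h.q_pos t ht)).le, inv_inv]

/-- Size conditions on `δ` under which a pair within weighted distance `δ` of the reference orbit
remains in the region where the perturbed flow is described. -/
theorem mem_region_of_close (h : IsReferenceOrbit m (r⁻¹ ^ 2) c ps qs) (hr : 0 < r)
    {δ pb qb t : ℝ} (hδc : δ ≤ c / 2) (hδr : δ ≤ r / 4) (ht : 0 ≤ t) (hpb : |pb| ≤ δ * (1 + t))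
    (hqb : (1 + t) ^ 2 * |qb| ≤ δ) :
    ps t / 2 ≤ ps t + pb ∧ 0 < qs t + qb ∧
      (qs t + qb)⁻¹ ^ 2 ∈ Icc ((qs 0)⁻¹ ^ 2 / 2) (2 * r⁻¹ ^ 2) := by
  have hqr := h.le_q hr ht
  have hq0 := h.q_le t ht
  have hqr0 := h.le_q hr le_rfl
  have hqb' : |qb| ≤ r / 4 := by
    refine le_trans ?_ (hqb.trans hδr)
    exact le_mul_of_one_le_left (abs_nonneg _) (one_le_pow₀ (by linarith))
  have h1 := abs_le.1 hqb'
  have h2 : 3 / 4 * r ≤ qs t + qb := by linarith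
  have h3 : qs t + qb ≤ 5 / 4 * qs 0 := by linarith
  have h4 : 0 < qs t + qb := by linarith
  have h0 : 0 < qs 0 := h.q_pos 0 le_rfl
  refine ⟨?_, h4, ?_, ?_⟩
  · have h5 : δ * (1 + t) ≤ c / 2 * (1 + t) := mul_le_mul_of_nonneg_right hδc (by linarith)
    have h6 := h.le_p t ht
    have h7 := (abs_le.1 hpb).1
    linarith
  · calc (qs 0)⁻¹ ^ 2 / 2 ≤ (5 / 4 * qs 0)⁻¹ ^ 2 := by
          have h1 : ((5 / 4 : ℝ)⁻¹) ^ 2 = 16 / 25 := by norm_num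
          have h2 : 0 < (qs 0)⁻¹ ^ 2 := by positivity
          rw [mul_inv, mul_pow, h1]
          linarith
      _ ≤ (qs t + qb)⁻¹ ^ 2 := by gcongr
  · calc (qs t + qb)⁻¹ ^ 2 ≤ (3 / 4 * r)⁻¹ ^ 2 := by gcongr
      _ ≤ 2 * r⁻¹ ^ 2 := by
          have h1 : ((3 / 4 : ℝ)⁻¹) ^ 2 = 16 / 9 := by norm_num
          have h2 : 0 < r⁻¹ ^ 2 := by positivity
          rw [mul_inv, mul_pow, h1]
          linarith

end IsReferenceOrbit

/-- Cutoff of `u ↦ g (u^(-1/2) / ε)` outside `[u₀, b]`, continuous and with the same bound. -/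
theorem exists_cutoff {g : ℝ → ℝ} {ε η u₀ b : ℝ} (hg : Continuous g) (hε : 0 < ε) (hu₀ : 0 < u₀)
    (hη : ∀ x, 0 < x → |g x| ≤ η) :
    ∃ G : ℝ → ℝ, Continuous G ∧ (∀ u, |G u| ≤ η) ∧
      ∀ q, 0 < q → q⁻¹ ^ 2 ∈ Icc u₀ b → G (q⁻¹ ^ 2) = g (q / ε) := by
  have hpos : ∀ u, 0 < √(max u₀ (min u b)) := fun u =>
    Real.sqrt_pos.2 (hu₀.trans_le (le_max_left _ _))
  refine ⟨fun u => g ((√(max u₀ (min u b)))⁻¹ / ε), ?_, fun u => ?_, fun q hq hqu => ?_⟩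
  · exact hg.comp ((Continuous.inv₀ (by fun_prop) fun u => (hpos u).ne').div_const ε)
  · exact hη _ (div_pos (inv_pos.2 (hpos u)) hε)
  · simp only [min_eq_left hqu.2, max_eq_right hqu.1, Real.sqrt_sq (inv_pos.2 hq).le, inv_inv]

theorem sq_mul_abs_log_le {ε : ℝ} (hε : 0 < ε) (hε1 : ε ≤ 1) : ε ^ 2 * |Real.log ε| ≤ ε := by
  have h := Real.abs_log_mul_self_lt ε hε hε1
  rw [abs_mul, abs_of_pos hε] at h
  nlinarith

/-- Theorem on the modified trajectory: for any `C²` function `g` with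
`|g| + |g'| + |g''| ≤ C₀ε²`, and all sufficiently small `ε`, there is a unique small
correction `ξ̄ = (p̄, q̄)` (with `p̄(0) = 0`, `q̄(t) → 0`, lying in the weighted ball of
radius `ε²|log ε|`) such that `ξ₀ = ξ* + ξ̄` solves the modified point-vortex system
`ṗ₀ = F(q₀,p₀) + g(q₀/ε)`, `q̇₀ = −F(p₀,q₀)`; moreover it satisfies the stated
weighted bounds with an absolute constant `C`. -/
theorem statement_11 (m Q₀ qinf ϑ₀ C₀ : ℝ) (hm : 0 < m) (hQ₀ : 1 < Q₀)
    (hq : qinf ∈ Ioo Q₀⁻¹ Q₀) (hϑ : ϑ₀ ∈ Ioo (0:ℝ) (π / 2)) (hC₀ : 0 < C₀) :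
    ∃ C > 0, ∃ ε₀ > 0, ∀ ε : ℝ, 0 < ε → ε < ε₀ →
      ∀ g : ℝ → ℝ, ContDiff ℝ 2 g →
        (∀ r : ℝ, 0 < r → |g r| + |deriv g r| + |deriv (deriv g) r| ≤ C₀ * ε ^ 2) →
        ∃ pb qb : ℝ → ℝ,
          (pb 0 = 0 ∧ Tendsto qb atTop (𝓝 0) ∧
            (∀ t : ℝ, 0 ≤ t → |pb t| ≤ ε ^ 2 * |Real.log ε| * (1 + t)) ∧
            (∀ t : ℝ, 0 ≤ t → (1 + t) ^ 2 * |qb t| ≤ ε ^ 2 * |Real.log ε|) ∧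
            (∀ t : ℝ, 0 ≤ t →
              HasDerivAt (fun τ : ℝ => pstarF m qinf ϑ₀ τ + pb τ)
                (Fpv m (qstarF m qinf ϑ₀ t + qb t) (pstarF m qinf ϑ₀ t + pb t)
                  + g ((qstarF m qinf ϑ₀ t + qb t) / ε)) t ∧
              HasDerivAt (fun τ : ℝ => qstarF m qinf ϑ₀ τ + qb τ)
                (-Fpv m (pstarF m qinf ϑ₀ t + pb t) (qstarF m qinf ϑ₀ t + qb t)) t)) ∧
          (∀ pb' qb' : ℝ → ℝ,
            (pb' 0 = 0 ∧ Tendsto qb' atTop (𝓝 0) ∧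
              (∀ t : ℝ, 0 ≤ t → |pb' t| ≤ ε ^ 2 * |Real.log ε| * (1 + t)) ∧
              (∀ t : ℝ, 0 ≤ t → (1 + t) ^ 2 * |qb' t| ≤ ε ^ 2 * |Real.log ε|) ∧
              (∀ t : ℝ, 0 ≤ t →
                HasDerivAt (fun τ : ℝ => pstarF m qinf ϑ₀ τ + pb' τ)
                  (Fpv m (qstarF m qinf ϑ₀ t + qb' t) (pstarF m qinf ϑ₀ t + pb' t)
                    + g ((qstarF m qinf ϑ₀ t + qb' t) / ε)) t ∧
                HasDerivAt (fun τ : ℝ => qstarF m qinf ϑ₀ τ + qb' τ)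
                  (-Fpv m (pstarF m qinf ϑ₀ t + pb' t) (qstarF m qinf ϑ₀ t + qb' t)) t)) →
            ∀ t : ℝ, 0 ≤ t → pb' t = pb t ∧ qb' t = qb t) ∧
          (∀ t : ℝ, 0 ≤ t →
            |pb t| ≤ C * ε ^ 2 * (1 + t) ∧
            |deriv pb t| ≤ C * ε ^ 2 ∧
            (1 + t) ^ 2 * |qb t| ≤ C * ε ^ 2 ∧
            (1 + t) ^ 3 * |deriv qb t| ≤ C * ε ^ 2) := by
  have hr : 0 < qinf := (inv_pos.2 (one_pos.trans hQ₀)).trans hq.1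
  obtain ⟨c, hc, hR⟩ := isReferenceOrbit_star hm hr hϑ
  have hps0 : 0 < pstarF m qinf ϑ₀ 0 := pstarF_pos hr 0
  set ps := pstarF m qinf ϑ₀
  set qs := qstarF m qinf ϑ₀
  have ha : 0 < qinf⁻¹ ^ 2 := by positivity
  have hqs0 : 0 < qs 0 := hR.q_pos 0 le_rfl
  have hu₀ : 0 < (qs 0)⁻¹ ^ 2 / 2 := by positivity
  have hsum := hR.add_eq 0 le_rfl
  have hu₀a : (qs 0)⁻¹ ^ 2 / 2 ≤ qinf⁻¹ ^ 2 := by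
    have := sq_nonneg (ps 0)⁻¹
    linarith
  have hp₀a : (ps 0)⁻¹ ^ 2 = qinf⁻¹ ^ 2 - 2 * ((qs 0)⁻¹ ^ 2 / 2) := by linarith
  obtain ⟨K, hK, h₀, hh₀, h₁, hh₁, η₀, hη₀, hflow⟩ :=
    exists_perturbedFlow hm ha hu₀ hu₀a hps0
  obtain ⟨C, hC, hest⟩ := exists_perturbedFlow_estimates hm ha hu₀ hps0 hK hh₀ hh₁ hc hR rfl
    (by ring)
  refine ⟨C * C₀, by positivity, min (min 1 (η₀ / C₀))
    (min (Real.exp (-(C * C₀))) (min (c / 2) (qinf / 4))), by positivity, ?_⟩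
  intro ε hε hεlt g hg hgb
  simp only [lt_min_iff] at hεlt
  obtain ⟨⟨hε1, hεη⟩, hεC, hεc, hεr⟩ := hεlt
  have hη : C₀ * ε ^ 2 ≤ η₀ := by
    rw [lt_div_iff₀ hC₀] at hεη
    nlinarith
  have hlog : C * C₀ ≤ |Real.log ε| := by
    have h1 := (Real.log_lt_iff_lt_exp hε).2 hεC
    have h2 := neg_abs_le (Real.log ε)
    linarith
  have hδ := sq_mul_abs_log_le hε hε1.le
  have hgη : ∀ x, 0 < x → |g x| ≤ C₀ * ε ^ 2 := fun x hx => by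
    have := hgb x hx
    have := abs_nonneg (deriv g x)
    have := abs_nonneg (deriv (deriv g) x)
    linarith
  obtain ⟨G, hGc, hGη, hGg⟩ := exists_cutoff (b := 2 * qinf⁻¹ ^ 2) hg.continuous hε hu₀ hgη
  obtain ⟨F⟩ := hflow _ hη G hGc hGη
  have hF := hest _ G F hGη
  have hKη : 0 ≤ K * (C₀ * ε ^ 2) := by positivity
  have hball : C * (C₀ * ε ^ 2) ≤ ε ^ 2 * |Real.log ε| := by
    nlinarith [mul_le_mul_of_nonneg_right hlog (sq_nonneg ε)]
  have hQ : ∀ t, 0 ≤ t → G (F.U ((F.P t)⁻¹ ^ 2)) = g (F.Q t / ε) := fun t ht => by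
    have hU := F.U_mem_Icc hKη hu₀ (sq_nonneg (F.P t)⁻¹) (F.inv_P_sq_le hps0 hh₀ hp₀a ht)
    have hu : 0 < F.U ((F.P t)⁻¹ ^ 2) := hu₀.trans_le hU.1
    have hQu : (F.Q t)⁻¹ ^ 2 = F.U ((F.P t)⁻¹ ^ 2) := by
      rw [PerturbedFlow.Q, inv_inv, Real.sq_sqrt hu.le]
    rw [← hQu]
    exact hGg _ (inv_pos.2 (Real.sqrt_pos.2 hu)) (by rwa [hQu])
  have hdP := fun t (ht : 0 ≤ t) => F.hasDerivAt_P_Fpv hKη hu₀ hps0 hh₀ hp₀a ht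
  have hdQ := fun t (ht : 0 ≤ t) => F.hasDerivAt_Q_Fpv hm hKη hu₀ hps0 hh₀ hp₀a ht
  have hqb0 : Tendsto (fun t => F.Q t - qs t) atTop (𝓝 0) := by
    have h1 : Tendsto (fun t : ℝ => C * (C₀ * ε ^ 2) * (1 + t)⁻¹) atTop (𝓝 0) := by
      simpa using (tendsto_inv_atTop_zero.comp
        (tendsto_atTop_add_const_left atTop (1 : ℝ) tendsto_id)).const_mul (C * (C₀ * ε ^ 2))
    refine squeeze_zero_norm' ?_ h1
    filter_upwards [eventually_ge_atTop (0 : ℝ)] with t ht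
    have h2 := (hF t ht).2.2.1
    rw [Real.norm_eq_abs, ← div_eq_mul_inv, le_div_iff₀ (by linarith)]
    nlinarith [mul_nonneg (abs_nonneg (F.Q t - qs t)) ht,
      mul_nonneg (mul_nonneg (abs_nonneg (F.Q t - qs t)) ht) ht]
  refine ⟨fun t => F.P t - ps t, fun t => F.Q t - qs t, ⟨?_, hqb0, ?_, ?_, ?_⟩, ?_, ?_⟩
  · simp [F.P_zero]
  · intro t ht
    exact (hF t ht).1.trans (mul_le_mul_of_nonneg_right hball (by linarith))
  · intro t ht
    exact (hF t ht).2.2.1.trans hball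
  · intro t ht
    simp only [add_sub_cancel]
    rw [← hQ t ht]
    exact ⟨hdP t ht, hdQ t ht⟩
  · rintro pb' qb' ⟨hp0, hq0, hpb, hqb, hode⟩ t ht
    have hreg := fun t (ht : 0 ≤ t) => hR.mem_region_of_close hr (hδ.trans hεc.le)
      (hδ.trans hεr.le) ht (hpb t ht) (hqb t ht)
    have htop : Tendsto (fun t => ps t + pb' t) atTop atTop := by
      refine tendsto_atTop_mono' _ ?_ ((hR.tendsto_p hc).atTop_div_const two_pos)
      filter_upwards [eventually_ge_atTop (0 : ℝ)] with t ht
      exact (hreg t ht).1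
    have hlim : Tendsto (fun t => qs t + qb' t) atTop (𝓝 qinf) := by
      simpa using (hR.tendsto_q hr hc).add hq0
    have h := F.eq_P_and_eq_Q hm ha hu₀ hps0 hh₀ hr rfl (p := fun t => ps t + pb' t)
      (q := fun t => qs t + qb' t) (by simp [hp0])
      (fun t ht => by linarith [(hreg t ht).1, hR.p_zero_le t ht]) htop
      (fun t ht => (hreg t ht).2.1) (fun t ht => (hreg t ht).2.2) hlim
      (fun t ht => by
        rw [hGg _ (hreg t ht).2.1 (hreg t ht).2.2]
        exact (hode t ht).1)
      (fun t ht => (hode t ht).2) ht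
    exact ⟨by linarith [h.1], by linarith [h.2]⟩
  · intro t ht
    obtain ⟨h1, h2, h3, h4⟩ := hF t ht
    have hC' : C * (C₀ * ε ^ 2) = C * C₀ * ε ^ 2 := by ring
    rw [hC'] at h1 h2 h3 h4
    refine ⟨h1, ?_, h3, ?_⟩
    · rwa [((hdP t ht).fun_sub (hR.hasDerivAt_p t ht)).deriv]
    · rwa [((hdQ t ht).fun_sub (hR.hasDerivAt_q t ht)).deriv]
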